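/- Let D be a 3-regular acyclic finite directed multigraph with a unique source s and a unique sink t. Then the number of source-to-sink paths of D equals 3 + Σ μ_D(v), where the sum ranges over all vertices v ∉ {s, t} with outdeg(v) = 2. -/

import Mathlib

/-- A finite directed multigraph with vertex set `Fin m` and edge set `Fin q`,
given by source and target maps. -/
structure Multigraph (m q : ℕ) where
  src : Fin q → Fin m
  tgt : Fin q → Fin m

namespace Multigraph

variable {m q : ℕ}

/-- `p` is a directed path from `u` to `v`: a nonempty list of edges whose first edge
starts at `u`, whose last edge ends at `v`, and where consecutive edges are composable. -/
def IsPath (D : Multigraph m q) (u v : Fin m) (p : List (Fin q)) : Prop :=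
  (∃ e rest, p = e :: rest ∧ D.src e = u) ∧
  (∃ e rest, p = rest ++ [e] ∧ D.tgt e = v) ∧
  p.Chain' (fun a b => D.tgt a = D.src b)

/-- The number of directed paths from `u` to `v` (paths counted as edge sequences). -/
noncomputable def pathCount (D : Multigraph m q) (u v : Fin m) : ℕ :=
  Nat.card {p : List (Fin q) // D.IsPath u v p}

/-- `D` is acyclic: no vertex has a directed path to itself. -/
def Acyclic (D : Multigraph m q) : Prop :=
  ∀ v : Fin m, ¬ ∃ p, D.IsPath v v p

/-- In-degree of a vertex. -/
def indeg (D : Multigraph m q) (v : Fin m) : ℕ :=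
  (Finset.univ.filter (fun e => D.tgt e = v)).card

/-- Out-degree of a vertex. -/
def outdeg (D : Multigraph m q) (v : Fin m) : ℕ :=
  (Finset.univ.filter (fun e => D.src e = v)).card

/-- `D` is 3-regular: every vertex has total degree 3. -/
def ThreeRegular (D : Multigraph m q) : Prop :=
  ∀ v : Fin m, D.indeg v + D.outdeg v = 3

/-- `s` is the unique source (vertex of in-degree 0) of `D`. -/
def UniqueSource (D : Multigraph m q) (s : Fin m) : Prop :=
  D.indeg s = 0 ∧ ∀ v : Fin m, D.indeg v = 0 → v = s

/-- `t` is the unique sink (vertex of out-degree 0) of `D`. -/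
def UniqueSink (D : Multigraph m q) (t : Fin m) : Prop :=
  D.outdeg t = 0 ∧ ∀ v : Fin m, D.outdeg v = 0 → v = t

/-- `μ_D(v)`: the number of directed paths from `s` to `v`, with `μ_D(s) = 1`. -/
noncomputable def mu (D : Multigraph m q) (s v : Fin m) : ℕ :=
  if v = s then 1 else D.pathCount s v

/-- Two vertices are adjacent (disregarding orientation) via an edge in `S`. -/
def Adj (D : Multigraph m q) (S : Set (Fin q)) (a b : Fin m) : Prop :=
  ∃ e ∈ S, (D.src e = a ∧ D.tgt e = b) ∨ (D.src e = b ∧ D.tgt e = a)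

/-- Weak connectivity using only the edges in `S`: any two distinct vertices are joined
by a finite sequence of edges of `S` traversed in either direction. -/
def WeaklyConnectedOn (D : Multigraph m q) (S : Set (Fin q)) : Prop :=
  ∀ a b : Fin m, a ≠ b → Relation.ReflTransGen (D.Adj S) a b

/-- `D` is weakly connected. -/
def WeaklyConnected (D : Multigraph m q) : Prop :=
  D.WeaklyConnectedOn Set.univ

/-- `D` is `ℓ`-edge connected: it has at least two vertices, and deleting any set of at
most `ℓ - 1` edges leaves a weakly connected multigraph. -/
def EdgeConnected (D : Multigraph m q) (ℓ : ℕ) : Prop :=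
  2 ≤ m ∧ ∀ F : Finset (Fin q), F.card ≤ ℓ - 1 → D.WeaklyConnectedOn {e | e ∉ F}

/-- `p` is a directed Hamiltonian path of `D` starting at `u`: a directed path that
visits every vertex exactly once. -/
def IsHamiltonianPath (D : Multigraph m q) (u : Fin m) (p : List (Fin q)) : Prop :=
  (∃ v, D.IsPath u v p) ∧ (u :: p.map D.tgt).Nodup ∧
    ∀ w : Fin m, w ∈ u :: p.map D.tgt

/-- `D` contains a directed Hamiltonian path. -/
def HasHamiltonianPath (D : Multigraph m q) : Prop :=
  ∃ u p, D.IsHamiltonianPath u p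

/-- `D` is simple: no two distinct edges have the same unordered pair of endpoints. -/
def Simple (D : Multigraph m q) : Prop :=
  ∀ e e' : Fin q, e ≠ e' →
    ¬ ((D.src e = D.src e' ∧ D.tgt e = D.tgt e') ∨
       (D.src e = D.tgt e' ∧ D.tgt e = D.src e'))

/-- `D` together with designated edges `H i` (from vertex `i` to vertex `i+1`, 0-based)
is a Hamiltonian-path digraph: the designated edges are pairwise distinct, form the
Hamiltonian path, and every edge goes from a smaller vertex to a larger one.
(Vertices `0, …, m-1` here represent the vertices `1, …, m`.) -/
def IsHamPathDigraph (D : Multigraph m q) (H : Fin (m - 1) → Fin q) : Prop :=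
  Function.Injective H ∧
  (∀ i : Fin (m - 1), (D.src (H i)).val = i.val ∧ (D.tgt (H i)).val = i.val + 1) ∧
  ∀ e : Fin q, (D.src e).val < (D.tgt e).val

end Multigraph
namespace Multigraph

variable {m q : ℕ}

/-- `p` is a possibly empty directed walk from `u` to `v`. -/
def IsWalk (D : Multigraph m q) (u v : Fin m) (p : List (Fin q)) : Prop :=
  D.IsPath u v p ∨ (p = [] ∧ u = v)

theorem not_isPath_nil (D : Multigraph m q) (u v : Fin m) : ¬ D.IsPath u v [] := by
  rintro ⟨⟨e, r, h, -⟩, -⟩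
  simp at h

theorem Acyclic.nodup_of_isChain {D : Multigraph m q} (hacy : D.Acyclic) (p : List (Fin q))
    (hp : p.IsChain (fun a b => D.tgt a = D.src b)) : p.Nodup := by
  induction p with
  | nil => exact List.nodup_nil
  | cons e l ih =>
    refine List.nodup_cons.2 ⟨fun he => ?_, ih hp.tail⟩
    obtain ⟨l₁, l₂, rfl⟩ := List.append_of_mem he
    rw [← List.cons_append] at hp
    have happ := List.isChain_append.1 hp
    obtain ⟨l₀, x, hx⟩ := List.eq_nil_or_concat (e :: l₁) |>.resolve_left (by simp)
    refine hacy (D.src e) ⟨e :: l₁, ⟨e, l₁, rfl, rfl⟩, ⟨x, l₀, by simpa using hx, ?_⟩, happ.1⟩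
    exact happ.2.2 x (by simp [hx]) e (by simp)

theorem IsWalk.isChain {D : Multigraph m q} {u v : Fin m} {p : List (Fin q)}
    (h : D.IsWalk u v p) : p.IsChain (fun a b => D.tgt a = D.src b) := by
  rcases h with h | ⟨rfl, -⟩
  · exact h.2.2
  · exact List.IsChain.nil

theorem Acyclic.finite_isWalk {D : Multigraph m q} (hacy : D.Acyclic) (u v : Fin m) :
    Finite {p : List (Fin q) // D.IsWalk u v p} :=
  Finite.of_injective
    (fun p => (⟨p.1, hacy.nodup_of_isChain p.1 p.2.isChain⟩ : {l : List (Fin q) // l.Nodup}))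
    (fun _ _ h => Subtype.ext (Subtype.mk.inj h))

theorem Acyclic.mu_eq_card_isWalk {D : Multigraph m q} (hacy : D.Acyclic) (s v : Fin m) :
    D.mu s v = Nat.card {p : List (Fin q) // D.IsWalk s v p} := by
  unfold mu
  split_ifs with h
  · subst h
    have hw : ∀ p, D.IsWalk v v p ↔ p = [] := fun p =>
      ⟨fun h => h.elim (fun h => (hacy v ⟨p, h⟩).elim) And.left, fun h => Or.inr ⟨h, rfl⟩⟩
    simp [hw]
  · have hw : ∀ p, D.IsWalk s v p ↔ D.IsPath s v p := fun p =>
      ⟨fun h' => h'.elim id (fun h' => (h h'.2.symm).elim), Or.inl⟩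
    simp [hw, pathCount]

theorem isWalk_append_singleton (D : Multigraph m q) (u v : Fin m) (l : List (Fin q))
    (e : Fin q) : D.IsWalk u v (l ++ [e]) ↔ D.IsWalk u (D.src e) l ∧ D.tgt e = v := by
  rcases List.eq_nil_or_concat l with rfl | ⟨l', x, rfl⟩
  · have : D.IsPath u v [e] ↔ D.src e = u ∧ D.tgt e = v := by
      constructor
      · rintro ⟨⟨a, r, h, ha⟩, ⟨b, r', h', hb⟩, -⟩
        have h1 : e = a := (List.cons.inj h).1
        have h2 : e = b := by simpa using congrArg List.getLast? h'
        subst h1 h2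
        exact ⟨ha, hb⟩
      · rintro ⟨h, h'⟩
        exact ⟨⟨e, [], rfl, h⟩, ⟨e, [], rfl, h'⟩, List.IsChain.singleton e⟩
    simp [IsWalk, this, not_isPath_nil, eq_comm]
  · simp only [IsWalk, List.concat_eq_append, List.append_eq_nil_iff, List.cons_ne_self,
      and_false, false_and, or_false]
    constructor
    · rintro ⟨⟨a, r, h, ha⟩, ⟨b, r', h', hb⟩, hc⟩
      have hc' := List.isChain_append.1 hc
      have h2 : e = b := by simpa using congrArg List.getLast? h'
      subst h2
      refine ⟨⟨?_, ⟨x, l', rfl, hc'.2.2 x (by simp) e (by simp)⟩, hc'.1⟩, hb⟩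
      cases l' with
      | nil => exact ⟨x, [], rfl, by simp at h; rw [h.1]; exact ha⟩
      | cons y l' => exact ⟨y, l' ++ [x], rfl, by simp at h; rw [h.1]; exact ha⟩
    · rintro ⟨⟨⟨a, r, h, ha⟩, ⟨b, r', h', hb⟩, hc⟩, hv⟩
      have h2 : x = b := by simpa using congrArg List.getLast? h'
      subst h2
      refine ⟨⟨a, r ++ [e], by rw [h]; rfl, ha⟩, ⟨e, _, rfl, hv⟩, ?_⟩
      refine List.isChain_append.2 ⟨hc, List.IsChain.singleton e, ?_⟩
      intro y hy z hz
      simp at hy hz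
      subst hy hz
      exact hb

/-- A walk to a vertex other than its start is a walk to the source of an incoming edge,
followed by that edge. -/
noncomputable def walkEquivSigma (D : Multigraph m q) {s v : Fin m} (hv : v ≠ s) :
    (Σ e : {e : Fin q // D.tgt e = v}, {p : List (Fin q) // D.IsWalk s (D.src e.1) p}) ≃
      {p : List (Fin q) // D.IsWalk s v p} :=
  Equiv.ofBijective
    (fun x => ⟨x.2.1 ++ [x.1.1], (D.isWalk_append_singleton s v _ _).2 ⟨x.2.2, x.1.2⟩⟩) <| by
    constructor
    · rintro ⟨⟨e, he⟩, p, hp⟩ ⟨⟨e', he'⟩, p', hp'⟩ h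
      obtain ⟨rfl, h'⟩ := List.append_inj' (congrArg Subtype.val h) rfl
      obtain rfl : e = e' := (List.cons.inj h').1
      rfl
    · rintro ⟨p, hp⟩
      rcases List.eq_nil_or_concat p with rfl | ⟨l, e, rfl⟩
      · exact (hp.elim (D.not_isPath_nil s v) (fun h => hv h.2.symm)).elim
      · rw [List.concat_eq_append] at hp
        have h := (D.isWalk_append_singleton s v l e).1 hp
        exact ⟨⟨⟨e, h.2⟩, l, h.1⟩, by simp⟩

theorem Acyclic.mu_eq_sum {D : Multigraph m q} (hacy : D.Acyclic) {s v : Fin m} (hv : v ≠ s) :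
    D.mu s v = ∑ e ∈ Finset.univ.filter (fun e => D.tgt e = v), D.mu s (D.src e) := by
  have := hacy.finite_isWalk
  rw [hacy.mu_eq_card_isWalk, ← Nat.card_congr (D.walkEquivSigma hv), Nat.card_sigma]
  simp only [hacy.mu_eq_card_isWalk]
  exact (Finset.sum_subtype _ (by simp)
    (fun e => Nat.card {p : List (Fin q) // D.IsWalk s (D.src e) p})).symm

/-- Double counting of walks from the source `s` extended by one edge. -/
theorem Acyclic.sum_mu_eq_sum_outdeg_mul_mu {D : Multigraph m q} (hacy : D.Acyclic) {s : Fin m}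
    (hs : D.indeg s = 0) :
    ∑ v, D.mu s v = 1 + ∑ v, D.outdeg v * D.mu s v := by
  have hin : ∑ v ∈ Finset.univ.erase s, D.mu s v = ∑ e, D.mu s (D.src e) := by
    rw [Finset.sum_congr rfl fun v hv => hacy.mu_eq_sum (Finset.ne_of_mem_erase hv)]
    refine Finset.sum_fiberwise_of_maps_to (fun e _ => ?_) _
    refine Finset.mem_erase.2 ⟨fun he => ?_, Finset.mem_univ _⟩
    exact Finset.notMem_empty e ((Finset.card_eq_zero.1 hs) ▸ by simp [he])
  have hout : ∑ e, D.mu s (D.src e) = ∑ v, D.outdeg v * D.mu s v := by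
    rw [← Finset.sum_fiberwise_of_maps_to (g := D.src) (fun e _ => Finset.mem_univ _)]
    refine Finset.sum_congr rfl fun v _ => ?_
    rw [Finset.sum_congr rfl (g := fun _ => D.mu s v)
      (fun e he => by rw [(Finset.mem_filter.1 he).2])]
    simp [outdeg]
  rw [← hout, ← hin, ← Finset.add_sum_erase _ _ (Finset.mem_univ s)]
  simp [mu]

end Multigraph

/-- For a 3-regular acyclic finite directed multigraph with unique source
`s` and unique sink `t`, the number of source-to-sink paths equals
`3 + Σ μ_D(v)` over all vertices `v ∉ {s, t}` of outdegree 2. -/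
theorem pathCount_eq_three_add_sum (m q : ℕ) (D : Multigraph m q) (s t : Fin m)
    (hreg : D.ThreeRegular) (hacy : D.Acyclic)
    (hs : D.UniqueSource s) (ht : D.UniqueSink t) :
    D.mu s t =
      3 + ∑ v ∈ Finset.univ.filter (fun v : Fin m => v ≠ s ∧ v ≠ t ∧ D.outdeg v = 2),
            D.mu s v := by
  have hst : s ≠ t := by
    rintro rfl
    have := hreg s
    have := hs.1
    have := ht.1
    omega
  have key := hacy.sum_mu_eq_sum_outdeg_mul_mu hs.1
  have hmu : D.mu s s = 1 := by simp [Multigraph.mu]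
  have hpt : ∀ v, D.outdeg v * D.mu s v + (if v = t then D.mu s t else 0) =
      D.mu s v + (if v = s then 2 else 0) +
        (if v ≠ s ∧ v ≠ t ∧ D.outdeg v = 2 then D.mu s v else 0) := by
    intro v
    by_cases hvs : v = s
    · subst hvs
      have : D.outdeg v = 3 := by have := hreg v; have := hs.1; omega
      simp [this, hst, hmu]
    by_cases hvt : v = t
    · subst hvt
      simp [ht.1, hvs]
    have h1 : D.indeg v ≠ 0 := fun h => hvs (hs.2 v h)
    have h2 : D.outdeg v ≠ 0 := fun h => hvt (ht.2 v h)
    have h3 := hreg v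
    have h4 : D.outdeg v = 1 ∨ D.outdeg v = 2 := by omega
    rcases h4 with h | h <;> simp [h, hvs, hvt, two_mul]
  have hsum := Finset.sum_congr (rfl : (Finset.univ : Finset (Fin m)) = Finset.univ)
    fun v _ => hpt v
  simp only [Finset.sum_add_distrib, Finset.sum_ite_eq', Finset.mem_univ, if_true] at hsum
  rw [Finset.sum_filter]
  omega
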